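/- Let p ≥ 0 and 0 < α < 2/(p+2). For each integer n ≥ 2 let g(n) := (n^{p+2}/(log(n^{p+2}))²)^{1/n}, let (X^{(n)}_k) be the biased simple random walk on ℤ started at 0 that steps right with probability g(n)/(1+g(n)) and left with probability 1/(1+g(n)), and let t(n) be positive integers with t(n)/(α n²/log n) → 1. Then liminf_{n→∞} log P[X^{(n)}_{t(n)} ≥ n] / log n ≥ −(α(p+2)−2)²/(8α); equivalently, P[X^{(n)}_{t(n)} ≥ n] > n^{−(α(p+2)−2)²/(8α)+o(1)}. -/

import Mathlib

open MeasureTheory Filter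
open scoped Classical ENNReal

namespace RWHitting

/-- A weighted graph on a vertex set `V`: a symmetric weight function with
positive finite vertex weights. -/
structure WeightedGraph (V : Type*) where
  w : V → V → ℝ≥0∞
  symm : ∀ x y, w x y = w y x
  vw_pos : ∀ x, 0 < ∑' y, w x y
  vw_lt_top : ∀ x, ∑' y, w x y < ⊤

namespace WeightedGraph

variable {V : Type*}

/-- The weight of a vertex. -/
noncomputable def vw (G : WeightedGraph V) (x : V) : ℝ≥0∞ := ∑' y, G.w x y

/-- The weight of a vertex set. -/
noncomputable def setWeight (G : WeightedGraph V) (z : Set V) : ℝ≥0∞ := ∑' x : z, G.vw x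

/-- `G.distGE o z m` : every path of positive-weight steps from `o` into `z` has length `≥ m`. -/
def distGE (G : WeightedGraph V) (o : V) (z : Set V) (m : ℕ) : Prop :=
  ∀ (k : ℕ) (p : ℕ → V), p 0 = o → (∀ i, i < k → 0 < G.w (p i) (p (i+1))) → p k ∈ z → m ≤ k

/-- Transition probabilities of the random walk on `G`. -/
noncomputable def trans (G : WeightedGraph V) (x y : V) : ℝ≥0∞ := G.w x y / G.vw x

/-- Graph distance (as an extended nonneg real). -/
noncomputable def edist (G : WeightedGraph V) (x y : V) : ℝ≥0∞ :=
  ⨅ (k : ℕ) (_ : ∃ p : ℕ → V, p 0 = x ∧ p k = y ∧ ∀ i, i < k → 0 < G.w (p i) (p (i+1))),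
    (k : ℝ≥0∞)

/-- Total weight of the edges at distance `n` from `o` (each non-loop edge counted in both
orientations). -/
noncomputable def boundaryWeight (G : WeightedGraph V) (o : V) (n : ℕ) : ℝ≥0∞ :=
  ∑' q : V × V, if min (G.edist o q.1) (G.edist o q.2) = (n : ℝ≥0∞) then G.w q.1 q.2 else 0

end WeightedGraph

variable {V : Type*}

/-- `μ` is the law of the random walk on `G` started at `o`. -/
def IsRandomWalk [MeasurableSpace V] (G : WeightedGraph V) (o : V)
    (μ : Measure (ℕ → V)) : Prop :=
  IsProbabilityMeasure μ ∧
  ∀ (k : ℕ) (x : Fin (k+1) → V),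
    μ {ω | ∀ i : Fin (k+1), ω (i : ℕ) = x i}
      = (if x 0 = o then 1 else 0) * ∏ i : Fin k, G.trans (x i.castSucc) (x i.succ)

/-- First hitting time of the set `z` (`∞` if `z` is never visited). -/
noncomputable def hitTime (z : Set V) (ω : ℕ → V) : ℝ≥0∞ :=
  ⨅ (k : ℕ) (_ : ω k ∈ z), (k : ℝ≥0∞)

/-- Expected hitting time of `z`. -/
noncomputable def expHit [MeasurableSpace V] (μ : Measure (ℕ → V)) (z : Set V) : ℝ≥0∞ :=
  ∫⁻ ω, hitTime z ω ∂μ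

/-- Number of visits to `o` (counting time 0) strictly before hitting `z`. -/
noncomputable def visitsBefore (z : Set V) (o : V) (ω : ℕ → V) : ℝ≥0∞ :=
  ∑' k : ℕ, if ω k = o ∧ (k : ℝ≥0∞) < hitTime z ω then 1 else 0

/-- Effective resistance between `o` and `z`, defined probabilistically via the random walk
law `μ`:  `w_o r_{oz}` is the expected number of visits to `o` before hitting `z`. -/
noncomputable def resistance [MeasurableSpace V] (G : WeightedGraph V) (o : V) (z : Set V)
    (μ : Measure (ℕ → V)) : ℝ≥0∞ :=
  (∫⁻ ω, visitsBefore z o ω ∂μ) / G.vw o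

/-- One-step transition probabilities for the biased simple random walk on `ℤ`
with odds `1 : g` of going left/right. -/
noncomputable def biasedStep (g : ℝ) (a b : ℤ) : ℝ≥0∞ :=
  if b = a + 1 then ENNReal.ofReal (g / (g+1))
  else if b = a - 1 then ENNReal.ofReal (1 / (g+1)) else 0

/-- `ν` is the law of the biased simple random walk on `ℤ` started at `0`,
stepping right with probability `g/(g+1)` and left with probability `1/(g+1)`. -/
def IsBiasedWalk (g : ℝ) (ν : Measure (ℕ → ℤ)) : Prop :=
  IsProbabilityMeasure ν ∧
  ∀ (k : ℕ) (x : Fin (k+1) → ℤ),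
    ν {ω | ∀ i : Fin (k+1), ω (i : ℕ) = x i}
      = (if x 0 = 0 then 1 else 0) * ∏ i : Fin k, biasedStep g (x i.castSucc) (x i.succ)

/-- `e^{-λ t}` for an extended-real time `t`, with the convention `e^{-λ ∞} = 0`. -/
noncomputable def expNeg (lam : ℝ) (t : ℝ≥0∞) : ℝ≥0∞ :=
  if t = ⊤ then 0 else ENNReal.ofReal (Real.exp (-lam * t.toReal))

/-- The nearest-neighbour path from `0` whose up-steps are exactly the times in `S`. -/
def upStepPath (S : Finset ℕ) (i : ℕ) : ℤ := ∑ j ∈ Finset.range i, if j ∈ S then 1 else -1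

theorem upStepPath_succ (S : Finset ℕ) (i : ℕ) :
    upStepPath S (i + 1) = upStepPath S i + if i ∈ S then 1 else -1 :=
  Finset.sum_range_succ _ _

theorem upStepPath_eq {S : Finset ℕ} {t : ℕ} (hS : S ⊆ Finset.range t) :
    upStepPath S t = 2 * S.card - t := by
  have h : ∀ j ∈ Finset.range t,
      (if j ∈ S then (1 : ℤ) else -1) = 2 * (if j ∈ S then 1 else 0) - 1 := by
    intro j _
    split_ifs <;> norm_num
  rw [upStepPath, Finset.sum_congr rfl h, Finset.sum_sub_distrib, ← Finset.mul_sum,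
    Finset.sum_ite_mem, Finset.inter_eq_right.2 hS]
  simp

/-- The event that the walk follows `upStepPath S` up to time `t`. -/
def upStepCylinder (t : ℕ) (S : Finset ℕ) : Set (ℕ → ℤ) :=
  {ω | ∀ i : Fin (t + 1), ω (i : ℕ) = upStepPath S i}

theorem measurableSet_upStepCylinder (t : ℕ) (S : Finset ℕ) :
    MeasurableSet (upStepCylinder t S) := by
  have : upStepCylinder t S = ⋂ i : Fin (t + 1), (fun ω : ℕ → ℤ => ω i) ⁻¹' {upStepPath S i} := by
    ext ω
    simp [upStepCylinder]
  rw [this]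
  exact MeasurableSet.iInter fun i => measurable_pi_apply _ (measurableSet_singleton _)

theorem pairwiseDisjoint_upStepCylinder (t : ℕ) :
    Set.PairwiseDisjoint ((Finset.range t).powerset : Set (Finset ℕ)) (upStepCylinder t) := by
  intro S hS T hT hne
  rw [Function.onFun, Set.disjoint_left]
  intro ω hωS hωT
  apply hne
  simp only [Finset.coe_powerset, Set.mem_preimage, Set.mem_powerset_iff, Finset.coe_subset]
    at hS hT
  have hpath : ∀ i ≤ t, upStepPath S i = upStepPath T i := fun i hi =>
    (hωS ⟨i, by omega⟩).symm.trans (hωT ⟨i, by omega⟩)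
  have hmem : ∀ i < t, (i ∈ S ↔ i ∈ T) := by
    intro i hi
    have h := hpath (i + 1) hi
    rw [upStepPath_succ, upStepPath_succ, hpath i hi.le] at h
    by_cases h1 : i ∈ S <;> by_cases h2 : i ∈ T <;> simp_all
  ext i
  by_cases hi : i < t
  · exact hmem i hi
  · exact iff_of_false (fun h => hi (Finset.mem_range.1 (hS h)))
      fun h => hi (Finset.mem_range.1 (hT h))

theorem IsBiasedWalk.measure_upStepCylinder {g : ℝ} {ν : Measure (ℕ → ℤ)} (hν : IsBiasedWalk g ν)
    {t : ℕ} {S : Finset ℕ} (hS : S ⊆ Finset.range t) :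
    ν (upStepCylinder t S) =
      ENNReal.ofReal (g / (g + 1)) ^ S.card * ENNReal.ofReal (1 / (g + 1)) ^ (t - S.card) := by
  have hstep : ∀ i : ℕ, biasedStep g (upStepPath S i) (upStepPath S (i + 1)) =
      if i ∈ S then ENNReal.ofReal (g / (g + 1)) else ENNReal.ofReal (1 / (g + 1)) := by
    intro i
    rw [upStepPath_succ, biasedStep]
    split_ifs <;> first | rfl | omega
  have h0 : upStepPath S 0 = 0 := by simp [upStepPath]
  have hcyl : ν (upStepCylinder t S) = _ := hν.2 t fun i => upStepPath S i
  rw [hcyl]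
  simp only [Fin.val_zero, h0, if_true, one_mul, Fin.val_castSucc, Fin.val_succ, hstep]
  rw [Fin.prod_univ_eq_prod_range (fun i => if i ∈ S then ENNReal.ofReal (g / (g + 1))
      else ENNReal.ofReal (1 / (g + 1))) t, Finset.prod_ite, Finset.prod_const, Finset.prod_const,
    Finset.filter_mem_eq_inter, Finset.inter_eq_right.2 hS, Finset.filter_notMem_eq_sdiff,
    Finset.card_sdiff_of_subset hS, Finset.card_range]

/-- The position of the biased walk at time `t` dominates the binomial tail. -/
theorem IsBiasedWalk.binomial_tail_le {g : ℝ} (hg : 0 < g) {ν : Measure (ℕ → ℤ)}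
    (hν : IsBiasedWalk g ν) (t n : ℕ) :
    ∑ k ∈ (Finset.range (t + 1)).filter fun k : ℕ => (n : ℤ) ≤ 2 * (k : ℤ) - t,
      (t.choose k : ℝ) * ((g / (g + 1)) ^ k * (1 / (g + 1)) ^ (t - k)) ≤
      (ν {ω | (n : ℤ) ≤ ω t}).toReal := by
  have := hν.1
  set U := (Finset.range t).powerset.filter fun S => (n : ℤ) ≤ 2 * (S.card : ℤ) - t with hU
  have hsub : ∀ S ∈ U, S ⊆ Finset.range t := fun S hS =>
    Finset.mem_powerset.1 (Finset.mem_filter.1 hS).1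
  have hle : (⋃ S ∈ U, upStepCylinder t S) ⊆ {ω | (n : ℤ) ≤ ω t} := by
    refine Set.iUnion₂_subset fun S hS ω hω => ?_
    have h : ω t = upStepPath S t := hω (Fin.last t)
    rw [Set.mem_ofPred_eq, h, upStepPath_eq (hsub S hS)]
    exact (Finset.mem_filter.1 hS).2
  have hdisj : Set.PairwiseDisjoint (U : Set (Finset ℕ)) (upStepCylinder t) :=
    (pairwiseDisjoint_upStepCylinder t).subset (Finset.coe_subset.2 (Finset.filter_subset _ _))
  calc _ = ∑ S ∈ U, (g / (g + 1)) ^ S.card * (1 / (g + 1)) ^ (t - S.card) := by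
        rw [hU, Finset.sum_filter, Finset.sum_filter, Finset.sum_powerset_apply_card (fun k =>
          if (n : ℤ) ≤ 2 * (k : ℤ) - t then (g / (g + 1)) ^ k * (1 / (g + 1)) ^ (t - k) else 0)]
        simp [Finset.card_range]
    _ = ν.real (⋃ S ∈ U, upStepCylinder t S) := by
        rw [measureReal_biUnion_finset hdisj fun S _ => measurableSet_upStepCylinder t S]
        refine Finset.sum_congr rfl fun S hS => ?_
        rw [measureReal_def, hν.measure_upStepCylinder (hsub S hS), ENNReal.toReal_mul,
          ENNReal.toReal_pow, ENNReal.toReal_pow, ENNReal.toReal_ofReal (by positivity),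
          ENNReal.toReal_ofReal (by positivity)]
    _ ≤ _ := measureReal_mono hle

open Real in
theorem logistic_pow_mul_pow (x : ℝ) {t k : ℕ} (hk : k ≤ t) :
    (exp (2 * x) / (exp (2 * x) + 1)) ^ k * (1 / (exp (2 * x) + 1)) ^ (t - k) =
      exp (x * (2 * k - t)) / (2 * cosh x) ^ t := by
  obtain ⟨d, rfl⟩ := Nat.exists_eq_add_of_le hk
  have h1 : exp (2 * x) + 1 = exp x * (2 * cosh x) := by
    rw [cosh_eq, mul_div_cancel₀ _ two_ne_zero, mul_add, ← exp_add, ← exp_add]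
    simp [two_mul]
  have h2 : exp (2 * x) / (exp (2 * x) + 1) = exp x / (2 * cosh x) := by
    rw [h1, two_mul x, exp_add, mul_div_mul_left _ _ (exp_ne_zero _)]
  have h3 : 1 / (exp (2 * x) + 1) = exp (-x) / (2 * cosh x) := by
    rw [h1, exp_neg]
    field_simp
  rw [h2, h3, Nat.add_sub_cancel_left, div_pow, div_pow, div_mul_div_comm, ← pow_add,
    ← exp_nat_mul, ← exp_nat_mul, ← exp_add]
  congr 2
  push_cast
  ring

/-- Chebyshev's inequality for the binomial distribution. -/
theorem one_sub_le_sum_binomial {q : ℝ} (hq0 : 0 ≤ q) (hq1 : q ≤ 1) (t : ℕ) {r : ℝ} (hr : 0 < r) :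
    1 - t / r ^ 2 ≤ ∑ k ∈ (Finset.range (t + 1)).filter
        fun k : ℕ => |2 * (k : ℝ) - t - t * (2 * q - 1)| < r,
      (t.choose k : ℝ) * (q ^ k * (1 - q) ^ (t - k)) := by
  set B : ℕ → ℝ := fun k => (t.choose k : ℝ) * (q ^ k * (1 - q) ^ (t - k)) with hB
  have hB0 : ∀ k, 0 ≤ B k := fun k => by
    have : 0 ≤ 1 - q := by linarith
    positivity
  have heval : ∀ k, (bernsteinPolynomial ℝ t k).eval q = B k := fun k => by
    simp [bernsteinPolynomial, hB, mul_assoc]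
  have hsum : ∑ k ∈ Finset.range (t + 1), B k = 1 := by
    have := congrArg (Polynomial.eval q) (bernsteinPolynomial.sum ℝ t)
    simpa [Polynomial.eval_finsetSum, heval] using this
  have hvar : ∑ k ∈ Finset.range (t + 1), (t * q - k) ^ 2 * B k = t * q * (1 - q) := by
    have := congrArg (Polynomial.eval q) (bernsteinPolynomial.variance ℝ t)
    simpa [Polynomial.eval_finsetSum, heval] using this
  have hfar : ∑ k ∈ (Finset.range (t + 1)).filter
      (fun k : ℕ => ¬ |2 * (k : ℝ) - t - t * (2 * q - 1)| < r), B k ≤ t / r ^ 2 := by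
    have hq : 4 * (q * (1 - q)) ≤ 1 := by nlinarith [sq_nonneg (2 * q - 1)]
    calc _ ≤ ∑ k ∈ (Finset.range (t + 1)).filter
          (fun k : ℕ => ¬ |2 * (k : ℝ) - t - t * (2 * q - 1)| < r),
            4 / r ^ 2 * ((t * q - k) ^ 2 * B k) := by
          refine Finset.sum_le_sum fun k hk => ?_
          have h := not_lt.1 (Finset.mem_filter.1 hk).2
          have h1 : r ^ 2 ≤ 4 * (t * q - k) ^ 2 := by
            calc r ^ 2 ≤ |2 * (k : ℝ) - t - t * (2 * q - 1)| ^ 2 := by gcongr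
              _ = 4 * (t * q - k) ^ 2 := by rw [sq_abs]; ring
          have h2 : 1 ≤ 4 / r ^ 2 * (t * q - k) ^ 2 := by
            rw [div_mul_eq_mul_div, one_le_div (by positivity)]
            exact h1
          rw [← mul_assoc]
          exact le_mul_of_one_le_left (hB0 k) h2
      _ ≤ ∑ k ∈ Finset.range (t + 1), 4 / r ^ 2 * ((t * q - k) ^ 2 * B k) :=
          Finset.sum_le_sum_of_subset_of_nonneg (Finset.filter_subset _ _) fun k _ _ => by
            have := hB0 k
            positivity
      _ = t / r ^ 2 * (4 * (q * (1 - q))) := by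
          rw [← Finset.mul_sum, hvar]
          ring
      _ ≤ t / r ^ 2 := mul_le_of_le_one_right (by positivity) hq
  have hsplit := Finset.sum_filter_add_sum_filter_not (Finset.range (t + 1))
    (fun k : ℕ => |2 * (k : ℝ) - t - t * (2 * q - 1)| < r) B
  linarith

open Real in
/-- Lower tail bound for the biased walk obtained by tilting its bias from `exp (2 * β)` to
`exp (2 * θ)`. -/
theorem IsBiasedWalk.tilted_lower_bound {β θ : ℝ} (hβθ : β ≤ θ) {ν : Measure (ℕ → ℤ)}
    (hν : IsBiasedWalk (exp (2 * β)) ν) {t n : ℕ} {r b : ℝ} (hr : 0 < r)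
    (htr : t / r ^ 2 ≤ 1 / 2) (hn : n + r ≤ t * tanh θ) (hb : t * tanh θ + r ≤ b) :
    1 / 2 * (cosh θ / cosh β) ^ t * exp (-((θ - β) * b)) ≤
      (ν {ω | (n : ℤ) ≤ ω t}).toReal := by
  refine le_trans ?_ (hν.binomial_tail_le (exp_pos _) t n)
  set q := exp (2 * θ) / (exp (2 * θ) + 1) with hq
  have hpos : 0 < exp (2 * θ) := exp_pos _
  have hq' : 1 - q = 1 / (exp (2 * θ) + 1) := by
    rw [hq]
    field_simp
    ring
  have hq0 : 0 ≤ q := by positivity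
  have hq1 : q ≤ 1 := by
    have : 0 ≤ 1 - q := by rw [hq']; positivity
    linarith
  have htanh : 2 * q - 1 = tanh θ := by
    rw [tanh_eq, hq, two_mul θ, exp_add, exp_neg]
    field_simp
    ring
  have hcheb := one_sub_le_sum_binomial hq0 hq1 t hr
  rw [htanh, hq'] at hcheb
  have hcβ := cosh_pos β
  have hcθ := cosh_pos θ
  set c := (cosh θ / cosh β) ^ t * exp (-((θ - β) * b)) with hc
  have hc0 : 0 ≤ c := by positivity
  calc 1 / 2 * (cosh θ / cosh β) ^ t * exp (-((θ - β) * b)) = c * (1 / 2) := by rw [hc]; ring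
    _ ≤ c * ∑ k ∈ (Finset.range (t + 1)).filter
          (fun k : ℕ => |2 * (k : ℝ) - t - t * tanh θ| < r),
        (t.choose k : ℝ) * (q ^ k * (1 / (exp (2 * θ) + 1)) ^ (t - k)) := by
        gcongr
        linarith
    _ ≤ ∑ k ∈ (Finset.range (t + 1)).filter
          (fun k : ℕ => |2 * (k : ℝ) - t - t * tanh θ| < r),
        (t.choose k : ℝ) * ((exp (2 * β) / (exp (2 * β) + 1)) ^ k *
          (1 / (exp (2 * β) + 1)) ^ (t - k)) := by
        rw [Finset.mul_sum]
        refine Finset.sum_le_sum fun k hk => ?_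
        obtain ⟨hkt, hk⟩ := Finset.mem_filter.1 hk
        have hkt : k ≤ t := Nat.lt_succ_iff.1 (Finset.mem_range.1 hkt)
        rw [logistic_pow_mul_pow θ hkt, logistic_pow_mul_pow β hkt, mul_left_comm]
        refine mul_le_mul_of_nonneg_left ?_ (Nat.cast_nonneg _)
        have hkb : 2 * (k : ℝ) - t ≤ b := by linarith [(abs_lt.1 hk).2]
        calc c * (exp (θ * (2 * k - t)) / (2 * cosh θ) ^ t)
            = exp (-((θ - β) * b) + θ * (2 * k - t)) / (2 * cosh β) ^ t := by
              rw [hc, exp_add, mul_pow, mul_pow, div_pow]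
              field_simp
          _ ≤ exp (β * (2 * k - t)) / (2 * cosh β) ^ t := by
              gcongr
              nlinarith [mul_nonneg (sub_nonneg.2 hβθ) (sub_nonneg.2 hkb)]
    _ ≤ _ := by
        refine Finset.sum_le_sum_of_subset_of_nonneg (fun k hk => ?_) fun k _ _ => by positivity
        obtain ⟨hkt, hk⟩ := Finset.mem_filter.1 hk
        refine Finset.mem_filter.2 ⟨hkt, ?_⟩
        have h : (n : ℝ) ≤ 2 * (k : ℝ) - t := by linarith [(abs_lt.1 hk).1]
        exact_mod_cast h

open Real in
theorem one_add_sq_half_le_cosh (x : ℝ) : 1 + x ^ 2 / 2 ≤ cosh x := by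
  have h : cosh x = 1 + 2 * sinh (x / 2) ^ 2 := by
    have h1 := cosh_two_mul (x / 2)
    rw [mul_div_cancel₀ _ two_ne_zero] at h1
    linarith [cosh_sq (x / 2)]
  have h2 : (x / 2) ^ 2 ≤ sinh (x / 2) ^ 2 := by
    rw [sq_le_sq, abs_sinh]
    exact self_le_sinh_iff.2 (abs_nonneg _)
  linarith

open Real in
theorem sq_half_div_le_log_cosh (x : ℝ) : x ^ 2 / 2 / (1 + x ^ 2 / 2) ≤ log (cosh x) := by
  have h1 : 0 < 1 + x ^ 2 / 2 := by positivity
  calc x ^ 2 / 2 / (1 + x ^ 2 / 2) = 1 - (1 + x ^ 2 / 2)⁻¹ := by field_simp; ring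
    _ ≤ log (1 + x ^ 2 / 2) := one_sub_inv_le_log_of_pos h1
    _ ≤ log (cosh x) := log_le_log h1 (one_add_sq_half_le_cosh x)

open Real in
theorem log_cosh_le_sq_half (x : ℝ) : log (cosh x) ≤ x ^ 2 / 2 :=
  (log_le_log (cosh_pos x) (cosh_le_exp_half_sq x)).trans_eq (log_exp _)

open Real in
theorem tendsto_tanh_div_self : Tendsto (fun x : ℝ => tanh x / x) (nhdsWithin 0 {0}ᶜ) (nhds 1) := by
  have h : HasDerivAt tanh 1 0 := by
    have h1 := (hasDerivAt_sinh 0).div (hasDerivAt_cosh 0) (cosh_pos 0).ne'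
    have h2 : tanh = sinh / cosh := by
      ext x
      exact tanh_eq_sinh_div_cosh x
    rw [h2]
    exact h1.congr_deriv (by simp)
  have h3 := hasDerivAt_iff_tendsto_slope.1 h
  refine h3.congr fun x => ?_
  simp [slope_def_field]

open Real in
/-- Lower bound on the logarithmic decay rate of the tail of a walk with bias `exp (2 * β n)` at
time `t n ∼ α n² / log n`, obtained by tilting the bias to `exp (2 * a * log n / n)`. -/
theorem eventually_le_log_tail_div_log {α a b c v : ℝ} (hb : b < a) (ha : 1 < α * a)
    (ha0 : 0 < a) (hc : α * a < c)
    (hv : v < α * a ^ 2 / 2 - α * b ^ 2 / 2 - (a - b) * c) {β : ℕ → ℝ}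
    (hβ : Tendsto (fun n : ℕ => β n * n / log n) atTop (nhds b)) {t : ℕ → ℕ}
    (ht : Tendsto (fun n : ℕ => t n * log n / (n : ℝ) ^ 2) atTop (nhds α))
    {μ : ℕ → Measure (ℕ → ℤ)} (hμ : ∀ᶠ n in atTop, IsBiasedWalk (exp (2 * β n)) (μ n)) :
    ∀ᶠ n : ℕ in atTop, v ≤ log (μ n {ω | (n : ℤ) ≤ ω (t n)}).toReal / log n := by
  have hlog : Tendsto (fun n : ℕ => log n) atTop atTop :=
    tendsto_log_atTop.comp tendsto_natCast_atTop_atTop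
  have hlog_pos : ∀ᶠ n : ℕ in atTop, 0 < log n := hlog.eventually_gt_atTop 0
  have hn_pos : ∀ᶠ n : ℕ in atTop, 0 < (n : ℝ) :=
    tendsto_natCast_atTop_atTop.eventually_gt_atTop 0
  set θ : ℕ → ℝ := fun n => a * (log n / n) with hθ
  have hθ0 : Tendsto θ atTop (nhds 0) := by
    have h : Tendsto (fun n : ℕ => log n / (n : ℝ)) atTop (nhds 0) :=
      isLittleO_log_id_atTop.tendsto_div_nhds_zero.comp tendsto_natCast_atTop_atTop
    simpa using h.const_mul a
  have hθ_pos : ∀ᶠ n in atTop, 0 < θ n := by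
    filter_upwards [hlog_pos, hn_pos] with n h1 h2
    positivity
  have htanh : Tendsto (fun n => t n * tanh (θ n) / n) atTop (nhds (α * a)) := by
    have h1 : Tendsto (fun n => tanh (θ n) / θ n) atTop (nhds 1) :=
      tendsto_tanh_div_self.comp (tendsto_nhdsWithin_iff.2
        ⟨hθ0, hθ_pos.mono fun n hn => hn.ne'⟩)
    have h2 := (ht.mul_const a).mul h1
    rw [mul_one] at h2
    refine h2.congr' ?_
    filter_upwards [hlog_pos, hn_pos] with n h1 h2
    simp only [hθ]
    field_simp
  have htn : Tendsto (fun n : ℕ => t n / (n : ℝ) ^ 2) atTop (nhds 0) := by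
    refine (ht.div_atTop hlog).congr' ?_
    filter_upwards [hlog_pos] with n h1
    field_simp
  obtain ⟨η, hη0, hη1, hη2⟩ : ∃ η : ℝ, 0 < η ∧ 1 + η < α * a ∧ α * a < c - η := by
    refine ⟨min (α * a - 1) (c - α * a) / 2, half_pos (lt_min (by linarith) (by linarith)), ?_, ?_⟩
    · linarith [min_le_left (α * a - 1) (c - α * a)]
    · linarith [min_le_right (α * a - 1) (c - α * a)]
  have hlim : Tendsto (fun n : ℕ => log (1 / 2) / log n +
      (t n * log n / (n : ℝ) ^ 2 * a ^ 2 / (2 * (1 + θ n ^ 2 / 2)) -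
        t n * log n / (n : ℝ) ^ 2 * (β n * n / log n) ^ 2 / 2) -
      (a - β n * n / log n) * c) atTop
      (nhds (α * a ^ 2 / 2 - α * b ^ 2 / 2 - (a - b) * c)) := by
    have h1 : Tendsto (fun n => 2 * (1 + θ n ^ 2 / 2)) atTop (nhds 2) := by
      simpa using (((hθ0.pow 2).div_const 2).const_add 1).const_mul 2
    simpa using ((hlog.const_div_atTop (log (1 / 2))).add
      (((ht.mul_const (a ^ 2)).div h1 two_ne_zero).sub ((ht.mul (hβ.pow 2)).div_const 2))).sub
      ((hβ.const_sub a).mul_const c)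
  filter_upwards [hlog_pos, hn_pos, hμ, hlim.eventually_const_lt hv, hβ.eventually_lt_const hb,
    htanh.eventually_const_lt hη1, htanh.eventually_lt_const hη2,
    htn.eventually_le_const (by positivity : 0 < η ^ 2 / 2)] with n hL hn hμn hvn hβn h1 h2 h3
  have hβθ : β n ≤ θ n := by
    rw [div_lt_iff₀ hL] at hβn
    simp only [hθ]
    rw [← mul_div_assoc, le_div_iff₀ hn]
    exact hβn.le
  rw [lt_div_iff₀ hn] at h1
  rw [div_lt_iff₀ hn] at h2
  have h4 : t n / (η * n) ^ 2 ≤ 1 / 2 := by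
    rw [div_le_iff₀ (by positivity)] at h3 ⊢
    linarith
  have hbound := hμn.tilted_lower_bound (n := n) (r := η * n) (b := c * n) hβθ (by positivity) h4
    (by linarith) (by linarith)
  have hcβ := cosh_pos (β n)
  have hcθ := cosh_pos (θ n)
  have hlogle := log_le_log (by positivity) hbound
  rw [log_mul (by positivity) (exp_ne_zero _), log_mul (by norm_num) (by positivity), log_pow,
    log_div hcθ.ne' hcβ.ne', log_exp] at hlogle
  refine hvn.le.trans ((le_div_iff₀ hL).2 (le_trans ?_ hlogle))
  have h5 : (t n : ℝ) * (θ n ^ 2 / 2 / (1 + θ n ^ 2 / 2) - β n ^ 2 / 2) ≤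
      t n * (log (cosh (θ n)) - log (cosh (β n))) := by
    gcongr
    · exact sq_half_div_le_log_cosh _
    · exact log_cosh_le_sq_half _
  have h6 : θ n * n = a * log n := by
    simp only [hθ]
    field_simp
  have h7 : t n * log n / (n : ℝ) ^ 2 * a ^ 2 * log n = t n * θ n ^ 2 := by
    simp only [hθ]
    field_simp
  have h8 : (0 : ℝ) < 1 + θ n ^ 2 / 2 := by positivity
  calc _ = log (1 / 2) + (t n * log n / (n : ℝ) ^ 2 * a ^ 2 * log n / (2 * (1 + θ n ^ 2 / 2)) -
        t n * β n ^ 2 / 2) - (a * log n - β n * n) * c := by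
        field_simp
    _ = log (1 / 2) + t n * (θ n ^ 2 / 2 / (1 + θ n ^ 2 / 2) - β n ^ 2 / 2) -
        (θ n - β n) * (c * n) := by
        rw [h7, ← h6]
        field_simp
    _ ≤ _ := by linarith

/-- Gaussian-type lower bound for the biased simple random walk on `ℤ`
with bias parameter `g(n) = (n^{p+2}/(log n^{p+2})²)^{1/n}`: if `t(n) ∼ α n²/log n` then
`liminf log P[X^{(n)}_{t(n)} ≥ n] / log n ≥ -(α(p+2)-2)²/(8α)`. -/
theorem biased_walk_position_tail_bound
    (p α : ℝ) (hp : 0 ≤ p) (hα : 0 < α) (hα' : α < 2 / (p + 2))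
    (g : ℕ → ℝ)
    (hg : ∀ n : ℕ, 2 ≤ n →
      g n = ((n : ℝ) ^ (p + 2) / (Real.log ((n : ℝ) ^ (p + 2))) ^ 2) ^ ((n : ℝ)⁻¹))
    (μ : ℕ → Measure (ℕ → ℤ))
    (hμ : ∀ n : ℕ, 2 ≤ n → IsBiasedWalk (g n) (μ n))
    (t : ℕ → ℕ) (ht : ∀ n, 0 < t n)
    (htasym : Tendsto (fun n : ℕ => (t n : ℝ) / (α * (n : ℝ) ^ 2 / Real.log n))
      atTop (nhds 1)) :
    -(α * (p + 2) - 2) ^ 2 / (8 * α) ≤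
      Filter.liminf
        (fun n : ℕ => Real.log (μ n {ω | (n : ℤ) ≤ ω (t n)}).toReal / Real.log n)
        atTop := by
 
  have hlog : Tendsto (fun n : ℕ => Real.log n) atTop atTop :=
    Real.tendsto_log_atTop.comp tendsto_natCast_atTop_atTop
  have hp2 : 0 < p + 2 := by linarith
  set β : ℕ → ℝ := fun n => Real.log (g n) / 2 with hβ_def
  have hβ : Tendsto (fun n : ℕ => β n * n / Real.log n) atTop (nhds ((p + 2) / 2)) := by
    have h1 : Tendsto (fun n : ℕ => Real.log ((p + 2) * Real.log n) / ((p + 2) * Real.log n))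
        atTop (nhds 0) :=
      Real.isLittleO_log_id_atTop.tendsto_div_nhds_zero.comp (hlog.const_mul_atTop hp2)
    have h2 : Tendsto (fun n : ℕ => (p + 2) / 2 -
        (p + 2) * (Real.log ((p + 2) * Real.log n) / ((p + 2) * Real.log n)))
        atTop (nhds ((p + 2) / 2)) := by
      simpa using (h1.const_mul (p + 2)).const_sub ((p + 2) / 2)
    refine h2.congr' ?_
    filter_upwards [eventually_ge_atTop 2, hlog.eventually_gt_atTop 0] with n hn hL
    have hn0 : (0 : ℝ) < n := by positivity
    have hpow : (0 : ℝ) < (n : ℝ) ^ (p + 2) := Real.rpow_pos_of_pos hn0 _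
    have hlogpow : 0 < (p + 2) * Real.log n := by positivity
    simp only [hβ_def]
    rw [hg n hn, Real.log_rpow hn0, Real.log_rpow (by positivity),
      Real.log_div hpow.ne' (by positivity), Real.log_pow, Real.log_rpow hn0]
    field_simp
    push_cast
    ring
  have htlog : Tendsto (fun n : ℕ => t n * Real.log n / (n : ℝ) ^ 2) atTop (nhds α) := by
    have h := htasym.const_mul α
    rw [mul_one] at h
    refine h.congr fun n => ?_
    rw [div_div_eq_mul_div, mul_div_assoc', mul_div_mul_left _ _ hα.ne']
  have hμ' : ∀ᶠ n in atTop, IsBiasedWalk (Real.exp (2 * β n)) (μ n) := by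
    filter_upwards [eventually_ge_atTop 2] with n hn
    have hn1 : (1 : ℝ) < n := by exact_mod_cast hn
    have hgpos : 0 < g n := by
      have h1 : 0 < Real.log ((n : ℝ) ^ (p + 2)) := Real.log_pos (Real.one_lt_rpow hn1 hp2)
      rw [hg n hn]
      positivity
    have h2 : Real.exp (2 * β n) = g n := by
      rw [hβ_def, mul_div_cancel₀ _ two_ne_zero, Real.exp_log hgpos]
    rw [h2]
    exact hμ n hn
  have hcobdd : IsCoboundedUnder (· ≥ ·) atTop
      (fun n : ℕ => Real.log (μ n {ω | (n : ℤ) ≤ ω (t n)}).toReal / Real.log n) := by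
    refine IsBoundedUnder.isCoboundedUnder_ge (isBoundedUnder_of_eventually_le (a := 0) ?_)
    filter_upwards [eventually_ge_atTop 2] with n hn
    have := (hμ n hn).1
    exact div_nonpos_of_nonpos_of_nonneg
      (Real.log_nonpos ENNReal.toReal_nonneg measureReal_le_one) (Real.log_natCast_nonneg n)
  set b := (p + 2) / 2 with hb
  have hbα : b < 1 / α := by
    rw [lt_div_iff₀ hp2] at hα'
    rw [hb, lt_div_iff₀ hα]
    linarith
  have hrate : ∀ δ : ℝ, 0 < δ →
      α * ((1 + δ) / α) ^ 2 / 2 - α * b ^ 2 / 2 - ((1 + δ) / α - b) * (1 + 2 * δ) ≤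
      liminf (fun n : ℕ => Real.log (μ n {ω | (n : ℤ) ≤ ω (t n)}).toReal / Real.log n)
        atTop := by
    intro δ hδ
    have hαa : α * ((1 + δ) / α) = 1 + δ := mul_div_cancel₀ _ hα.ne'
    refine le_of_forall_lt_imp_le_of_dense fun v hv => le_liminf_of_le hcobdd ?_
    refine eventually_le_log_tail_div_log (hbα.trans ?_) (by linarith) (by positivity)
      (by linarith) hv hβ htlog hμ'
    gcongr
    linarith
  have hlim : Tendsto (fun δ : ℝ =>
      α * ((1 + δ) / α) ^ 2 / 2 - α * b ^ 2 / 2 - ((1 + δ) / α - b) * (1 + 2 * δ))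
      (nhdsWithin 0 (Set.Ioi 0)) (nhds (-(α * (p + 2) - 2) ^ 2 / (8 * α))) := by
    have h : Continuous fun δ : ℝ =>
        α * ((1 + δ) / α) ^ 2 / 2 - α * b ^ 2 / 2 - ((1 + δ) / α - b) * (1 + 2 * δ) := by
      fun_prop
    convert (h.tendsto 0).mono_left nhdsWithin_le_nhds using 2
    rw [hb]
    field_simp
    ring
  exact le_of_tendsto hlim (eventually_nhdsWithin_of_forall hrate)

end RWHitting
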